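/- arXiv:0706.4015 — 2 statements merged into one kernel-verified Lean document; each statement's English description precedes it below -/
import Mathlib

section
/- Cover lemma: in any execution from a configuration in WU₀ in which every process has infinitely many events, let k ≥ ⊥₀ + D. For every event (p,t) with t ≥ t_{p,k} and every process q with d(p,q) ≤ ṽ(p,t) − k, there exists an event (q,t') with t_{q,k} ≤ t' and (q,t') ≼ (p,t); that is, the past cone of (p,t) within the interval [C_k, →[ covers the ball V(p, ṽ(p,t) − k). -/
open SimpleGraph

/-- The incrementing function `φ`: `φ(x) = (x+1) mod K` if `x ≥ 0`, and `x+1` if `x < 0`. -/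
def phiInc (K x : ℤ) : ℤ := if 0 ≤ x then (x + 1) % K else x + 1

/-- `dsub K a b` is `b ⊖ a`: `(b−a) mod K` if this residue is `≤ 1`, else `−((a−b) mod K)`,
for locally comparable ring values. -/
def dsub (K a b : ℤ) : ℤ := if (b - a) % K ≤ 1 then (b - a) % K else -((a - b) % K)

/-- Two ring values are locally comparable if `min((a−b) mod K, (b−a) mod K) ≤ 1`. -/
def LocComp (K a b : ℤ) : Prop := min ((a - b) % K) ((b - a) % K) ≤ 1

/-- `γ` takes values in `X = {−α,…,K−1}`. -/
def InX {V : Type*} (K α : ℤ) (γ : V → ℤ) : Prop := ∀ p : V, -α ≤ γ p ∧ γ p < K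

/-- The predicate `WU`: every process has a ring value (`{0,…,K−1}`) locally comparable
with the value of each of its neighbors. -/
def WU {V : Type*} (G : SimpleGraph V) (K : ℤ) (γ : V → ℤ) : Prop :=
  ∀ p q : V, G.Adj p q → (0 ≤ γ p ∧ γ p < K) ∧ LocComp K (γ p) (γ q)

/-- The delay of a walk: the sum of `γ(next) ⊖ γ(current)` along its edges. -/
def walkDelay {V : Type*} {G : SimpleGraph V} (K : ℤ) (γ : V → ℤ)
    {p q : V} (w : G.Walk p q) : ℤ :=
  (w.darts.map (fun d => dsub K (γ d.fst) (γ d.snd))).sum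

/-- The delay is intrinsic: independent of the choice of the path. -/
def Intrinsic {V : Type*} (G : SimpleGraph V) (K : ℤ) (γ : V → ℤ) : Prop :=
  ∀ p q : V, ∀ w₁ w₂ : G.Walk p q, walkDelay K γ w₁ = walkDelay K γ w₂

/-- `WU₀`: `WU` together with intrinsic delay. -/
def WU0 {V : Type*} (G : SimpleGraph V) (K : ℤ) (γ : V → ℤ) : Prop :=
  WU G K γ ∧ Intrinsic G K γ

/-- The normal action `NA` is enabled at `p`: `γ(p)` is a ring value and every neighbor `q`
satisfies `γ(q) = γ(p)` or `γ(q) = φ(γ(p))`. -/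
def NAenabled {V : Type*} (G : SimpleGraph V) (K : ℤ) (γ : V → ℤ) (p : V) : Prop :=
  (0 ≤ γ p ∧ γ p < K) ∧ ∀ q : V, G.Adj p q → γ q = γ p ∨ γ q = phiInc K (γ p)

/-- An NA-step: a nonempty set `S` of processes at which `NA` is enabled in `γ`
simultaneously execute it, all other processes keeping their value. -/
def NAstep {V : Type*} (G : SimpleGraph V) (K : ℤ) (γ γ' : V → ℤ) (S : Set V) : Prop :=
  S.Nonempty ∧ (∀ p ∈ S, NAenabled G K γ p) ∧
    ∀ p : V, (p ∈ S → γ' p = phiInc K (γ p)) ∧ (p ∉ S → γ' p = γ p)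

/-- `(p,t)` is an event: `t = 0`, or `p` executes `NA` in the step `γ_{t−1} ↦ γ_t`. -/
def isEvent {V : Type*} (sched : ℕ → Set V) (p : V) (t : ℕ) : Prop :=
  t = 0 ∨ ∃ s, t = s + 1 ∧ p ∈ sched s

/-- The causal relation `⤳` on events. -/
inductive Leads {V : Type*} (G : SimpleGraph V) (sched : ℕ → Set V) :
    V × ℕ → V × ℕ → Prop
  | self {p : V} {t' t : ℕ} : isEvent sched p t' → isEvent sched p t → t' < t →
      (∀ s, t' < s → s < t → ¬ isEvent sched p s) → Leads G sched (p, t') (p, t)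
  | nbr {p q : V} {t' t : ℕ} : G.Adj p q → isEvent sched p t → 0 < t →
      isEvent sched q t' → t' < t → (∀ s, t' < s → s < t → ¬ isEvent sched q s) →
      Leads G sched (q, t') (p, t)

/-- The causal order `≼`: reflexive-transitive closure of `⤳`. -/
def CausalLe {V : Type*} (G : SimpleGraph V) (sched : ℕ → Set V) :
    V × ℕ → V × ℕ → Prop :=
  Relation.ReflTransGen (Leads G sched)

/-- The lifted clock `ṽ(p,t) = ⊥₀ + δ(p₀,p) + #{s : 0 < s ≤ t and (p,s) is an event}`. -/
noncomputable def liftClock {V : Type*} (sched : ℕ → Set V) (bot0 : ℤ) (δ0 : V → ℤ)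
    (p : V) (t : ℕ) : ℤ :=
  bot0 + δ0 p + Nat.card {s : ℕ // 0 < s ∧ s ≤ t ∧ isEvent sched p s}

theorem isEvent_succ_iff {V : Type*} {sched : ℕ → Set V} {p : V} {t : ℕ} :
    isEvent sched p (t + 1) ↔ p ∈ sched t := by
  constructor
  · rintro (h | ⟨s, hs, hp⟩)
    · omega
    · obtain rfl : t = s := by omega
      exact hp
  · exact fun h => Or.inr ⟨t, rfl, h⟩

open Classical in
theorem liftClock_eq_count {V : Type*} (sched : ℕ → Set V) (b : ℤ) (δ : V → ℤ)
    (p : V) (t : ℕ) :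
    liftClock sched b δ p t = b + δ p + (Nat.count (fun s => p ∈ sched s) t : ℕ) := by
  unfold liftClock
  rw [Nat.subtype_card (((Finset.range t).filter (fun s => p ∈ sched s)).image Nat.succ),
    Finset.card_image_of_injective _ Nat.succ_injective, Nat.count_eq_card_filter_range]
  intro s
  simp only [Finset.mem_image, Finset.mem_filter, Finset.mem_range]
  constructor
  · rintro ⟨a, ⟨ha, hp⟩, rfl⟩
    exact ⟨Nat.succ_pos a, ha, isEvent_succ_iff.2 hp⟩
  · rintro ⟨hs, hst, hp⟩
    obtain ⟨a, rfl⟩ : ∃ a, s = a + 1 := ⟨s - 1, by omega⟩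
    exact ⟨a, ⟨by omega, isEvent_succ_iff.1 hp⟩, rfl⟩

theorem liftClock_zero {V : Type*} (sched : ℕ → Set V) (b : ℤ) (δ : V → ℤ) (p : V) :
    liftClock sched b δ p 0 = b + δ p := by
  simp [liftClock_eq_count]

theorem liftClock_succ_of_mem {V : Type*} {sched : ℕ → Set V} (b : ℤ) (δ : V → ℤ)
    {p : V} {t : ℕ} (h : p ∈ sched t) :
    liftClock sched b δ p (t + 1) = liftClock sched b δ p t + 1 := by
  classical
  rw [liftClock_eq_count, liftClock_eq_count, Nat.count_succ, if_pos h]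
  push_cast
  ring

theorem liftClock_succ_of_notMem {V : Type*} {sched : ℕ → Set V} (b : ℤ) (δ : V → ℤ)
    {p : V} {t : ℕ} (h : p ∉ sched t) :
    liftClock sched b δ p (t + 1) = liftClock sched b δ p t := by
  classical
  rw [liftClock_eq_count, liftClock_eq_count, Nat.count_succ, if_neg h, add_zero]

theorem liftClock_mono {V : Type*} (sched : ℕ → Set V) (b : ℤ) (δ : V → ℤ) (p : V) :
    Monotone (liftClock sched b δ p) := by
  refine monotone_nat_of_le_succ fun t => ?_
  by_cases h : p ∈ sched t
  · rw [liftClock_succ_of_mem b δ h]; omega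
  · rw [liftClock_succ_of_notMem b δ h]

/-- The latest event of `q` at or before time `t`; the lifted clock is constant since. -/
theorem exists_last_event {V : Type*} (sched : ℕ → Set V) (b : ℤ) (δ : V → ℤ)
    (q : V) (t : ℕ) :
    ∃ t' ≤ t, isEvent sched q t' ∧ (∀ s, t' < s → s ≤ t → ¬ isEvent sched q s) ∧
      liftClock sched b δ q t' = liftClock sched b δ q t := by
  induction t with
  | zero => exact ⟨0, le_rfl, Or.inl rfl, fun s h h' => by omega, rfl⟩
  | succ t ih =>
    by_cases h : q ∈ sched t
    · exact ⟨t + 1, le_rfl, isEvent_succ_iff.2 h, fun s h h' => by omega, rfl⟩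
    · obtain ⟨t', hle, hev, hlast, hclock⟩ := ih
      refine ⟨t', by omega, hev, fun s hs hst => ?_, ?_⟩
      · rcases Nat.lt_or_eq_of_le hst with hlt | rfl
        · exact hlast s hs (by omega)
        · rwa [isEvent_succ_iff]
      · rw [hclock, liftClock_succ_of_notMem b δ h]

theorem dsub_modEq (K a b : ℤ) : dsub K a b ≡ b - a [ZMOD K] := by
  unfold dsub
  split_ifs
  · exact Int.mod_modEq _ _
  · have := (Int.mod_modEq (a - b) K).neg
    rwa [neg_sub] at this

theorem abs_dsub_le_one {K a b : ℤ} (hK : 0 < K) (h : LocComp K a b) : |dsub K a b| ≤ 1 := by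
  have h₁ := Int.emod_nonneg (b - a) hK.ne'
  have h₂ := Int.emod_nonneg (a - b) hK.ne'
  unfold LocComp at h
  unfold dsub
  rw [abs_le]
  split_ifs <;> omega

theorem walkDelay_cons {V : Type*} {G : SimpleGraph V} (K : ℤ) (γ : V → ℤ) {p q r : V}
    (h : G.Adj p q) (w : G.Walk q r) :
    walkDelay K γ (Walk.cons h w) = dsub K (γ p) (γ q) + walkDelay K γ w := by
  simp [walkDelay]

theorem walkDelay_concat {V : Type*} {G : SimpleGraph V} (K : ℤ) (γ : V → ℤ) {p q r : V}
    (w : G.Walk p q) (h : G.Adj q r) :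
    walkDelay K γ (w.concat h) = walkDelay K γ w + dsub K (γ q) (γ r) := by
  simp [walkDelay]

theorem walkDelay_modEq {V : Type*} {G : SimpleGraph V} (K : ℤ) (γ : V → ℤ) {p q : V}
    (w : G.Walk p q) : walkDelay K γ w ≡ γ q - γ p [ZMOD K] := by
  induction w with
  | nil => simp [walkDelay]
  | @cons p q r h w ih =>
    rw [walkDelay_cons]
    convert (dsub_modEq K (γ p) (γ q)).add ih using 1
    ring

theorem walkDelay_le_length {V : Type*} {G : SimpleGraph V} {K : ℤ} (hK : 0 < K) {γ : V → ℤ}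
    (hγ : WU G K γ) {p q : V} (w : G.Walk p q) : walkDelay K γ w ≤ w.length := by
  induction w with
  | nil => simp [walkDelay]
  | cons h w ih =>
    rw [walkDelay_cons, Walk.length_cons]
    have := (abs_le.1 (abs_dsub_le_one hK (hγ _ _ h).2)).2
    push_cast
    omega

theorem phiInc_modEq {K x : ℤ} (hx : 0 ≤ x) : phiInc K x ≡ x + 1 [ZMOD K] := by
  rw [phiInc, if_pos hx]
  exact Int.mod_modEq _ _

theorem Int.ModEq.eq_of_abs_sub_lt {K a b : ℤ} (h : a ≡ b [ZMOD K]) (hlt : |a - b| < K) :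
    a = b := by
  have := Int.eq_zero_of_abs_lt_dvd h.symm.dvd hlt
  omega

/-- If `NA` is enabled at `p`, and the integers `x p` lift the values `γ p` and differ by at
most one between neighbors, then no neighbor of `p` is behind `p`. -/
theorem NAenabled.le_lift {V : Type*} {G : SimpleGraph V} {K : ℤ} (hK : 3 ≤ K)
    {γ x : V → ℤ} (hx : ∀ p, γ p ≡ x p [ZMOD K]) {p q : V} (h : NAenabled G K γ p)
    (hadj : G.Adj p q) (hpq : |x p - x q| ≤ 1) : x p ≤ x q := by
  rw [abs_le] at hpq
  rcases h.2 q hadj with hq | hq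
  · have hmod : x q ≡ x p [ZMOD K] := (hx q).symm.trans (hq ▸ hx p)
    have := hmod.eq_of_abs_sub_lt (by rw [abs_lt]; omega)
    omega
  · have hmod : x q ≡ x p + 1 [ZMOD K] :=
      (hx q).symm.trans (hq ▸ (phiInc_modEq h.1.1).trans ((hx p).add_right 1))
    have := hmod.eq_of_abs_sub_lt (by rw [abs_lt]; omega)
    omega

/-- Along an execution the lifted clock stays a lift of the configuration, and stays within
one unit between neighbors, provided this holds initially. -/
theorem liftClock_invariant {V : Type*} {G : SimpleGraph V} {K : ℤ} (hK : 3 ≤ K)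
    {e : ℕ → V → ℤ} {sched : ℕ → Set V} (hexec : ∀ t, NAstep G K (e t) (e (t + 1)) (sched t))
    {b : ℤ} {δ : V → ℤ} (hmod : ∀ p, e 0 p ≡ b + δ p [ZMOD K])
    (hadj : ∀ p q, G.Adj p q → |δ p - δ q| ≤ 1) (t : ℕ) :
    (∀ p, e t p ≡ liftClock sched b δ p t [ZMOD K]) ∧
      ∀ p q, G.Adj p q → |liftClock sched b δ p t - liftClock sched b δ q t| ≤ 1 := by
  induction t with
  | zero =>
    refine ⟨fun p => ?_, fun p q h => ?_⟩
    · rw [liftClock_zero]; exact hmod p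
    · rw [liftClock_zero, liftClock_zero, add_sub_add_left_eq_sub]; exact hadj p q h
  | succ t ih =>
    obtain ⟨ihmod, ihadj⟩ := ih
    obtain ⟨-, hen, hstep⟩ := hexec t
    refine ⟨fun p => ?_, fun p q h => ?_⟩
    · by_cases hp : p ∈ sched t
      · rw [(hstep p).1 hp, liftClock_succ_of_mem b δ hp]
        exact (phiInc_modEq (hen p hp).1.1).trans ((ihmod p).add_right 1)
      · rw [(hstep p).2 hp, liftClock_succ_of_notMem b δ hp]
        exact ihmod p
    · have hpq := ihadj p q h
      have hp_le (hp : p ∈ sched t) := (hen p hp).le_lift hK ihmod h hpq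
      have hq_le (hq : q ∈ sched t) := (hen q hq).le_lift hK ihmod h.symm (ihadj q p h.symm)
      rw [abs_le] at hpq ⊢
      by_cases hp : p ∈ sched t <;> by_cases hq : q ∈ sched t <;>
        simp only [liftClock_succ_of_mem, liftClock_succ_of_notMem, hp, hq, not_false_eq_true,
          true_imp_iff] at hp_le hq_le ⊢ <;> omega

/-- If neighbors of an executing process are never behind it and no clock starts above `k`,
then the past of an event whose clock exceeds `k` by at least the length of a walk contains an
event at the end of the walk whose clock is at least `k`. -/
theorem exists_causalLe_of_walk {V : Type*} {G : SimpleGraph V} {sched : ℕ → Set V} {b k : ℤ}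
    {δ : V → ℤ} (hlead : ∀ t p q, p ∈ sched t → G.Adj p q →
      liftClock sched b δ p t ≤ liftClock sched b δ q t)
    (hinit : ∀ p, liftClock sched b δ p 0 ≤ k) {p q : V} (w : G.Walk p q) {t : ℕ}
    (hev : isEvent sched p t) (hlen : w.length ≤ liftClock sched b δ p t - k) :
    ∃ t', isEvent sched q t' ∧ k ≤ liftClock sched b δ q t' ∧
      CausalLe G sched (q, t') (p, t) := by
  induction w generalizing t with
  | nil =>
    rw [Walk.length_nil] at hlen
    exact ⟨t, hev, by omega, Relation.ReflTransGen.refl⟩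
  | @cons p r q h w ih =>
    rw [Walk.length_cons] at hlen
    push_cast at hlen
    cases t with
    | zero => have := hinit p; omega
    | succ t =>
      have hp := isEvent_succ_iff.1 hev
      have hclock := liftClock_succ_of_mem b δ hp
      have hle := hlead t p r hp h
      obtain ⟨s, hst, hs, hlast, heq⟩ := exists_last_event sched b δ r t
      obtain ⟨t', ht', hk, hcausal⟩ := ih hs (by omega)
      exact ⟨t', ht', hk, hcausal.tail (Leads.nbr h hev (Nat.succ_pos t) hs (by omega)
        fun u hu hut => hlast u hu (by omega))⟩

/-- Cover lemma: in any execution from a configuration in `WU₀` in which every process has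
infinitely many events, let `k ≥ ⊥₀ + D`.  For every event `(p,t)` with `t ≥ t_{p,k}` and
every process `q` with `d(p,q) ≤ ṽ(p,t) − k`, there exists an event `(q,t')` with
`t_{q,k} ≤ t'` and `(q,t') ≼ (p,t)`: the past cone of `(p,t)` within the interval
`[C_k, →[` covers the ball `V(p, ṽ(p,t) − k)`.  Here `t_{p,k}` (resp. `t_{q,k}`) is
characterized as the least time at which the lifted clock of `p` (resp. `q`) equals `k`. -/
theorem cover_lemma {V : Type*} [Fintype V] (G : SimpleGraph V)
    (hconn : G.Connected) (hn : 2 ≤ Fintype.card V)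
    (K α : ℤ) (hK : 3 ≤ K) (hα : 0 ≤ α)
    (e : ℕ → V → ℤ) (sched : ℕ → Set V)
    (hX : ∀ t, ∀ p : V, -α ≤ e t p ∧ e t p < K)
    (hWU0 : WU G K (e 0) ∧ Intrinsic G K (e 0))
    (hexec : ∀ t, NAstep G K (e t) (e (t + 1)) (sched t))
    (hinf : ∀ (p : V) (T : ℕ), ∃ t, T < t ∧ isEvent sched p t)
    (p₀ : V) (δ0 : V → ℤ)
    (hδ0 : ∀ q : V, ∀ w : G.Walk p₀ q, walkDelay K (e 0) w = δ0 q)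
    (hmin : ∀ q : V, 0 ≤ δ0 q)
    (k : ℤ) (hk : e 0 p₀ + (G.diam : ℤ) ≤ k)
    (p : V) (t : ℕ) (hev : isEvent sched p t)
    (tpk : ℕ)
    (htpk : liftClock sched (e 0 p₀) δ0 p tpk = k ∧
      ∀ s, liftClock sched (e 0 p₀) δ0 p s = k → tpk ≤ s)
    (ht : tpk ≤ t)
    (q : V) (hq : (G.dist p q : ℤ) ≤ liftClock sched (e 0 p₀) δ0 p t - k)
    (tqk : ℕ)
    (htqk : liftClock sched (e 0 p₀) δ0 q tqk = k ∧
      ∀ s, liftClock sched (e 0 p₀) δ0 q s = k → tqk ≤ s) :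
    ∃ t' : ℕ, tqk ≤ t' ∧ isEvent sched q t' ∧ CausalLe G sched (q, t') (p, t) := by
  have hK0 : 0 < K := by omega
  have hmod : ∀ p, e 0 p ≡ e 0 p₀ + δ0 p [ZMOD K] := fun r => by
    obtain ⟨w⟩ := hconn p₀ r
    have := (walkDelay_modEq K (e 0) w).symm.add_left (e 0 p₀)
    rwa [hδ0, add_sub_cancel] at this
  have hadj : ∀ p q, G.Adj p q → |δ0 p - δ0 q| ≤ 1 := fun r s h => by
    obtain ⟨w⟩ := hconn p₀ r
    rw [← hδ0 s (w.concat h), walkDelay_concat, hδ0, sub_add_cancel_left, abs_neg]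
    exact abs_dsub_le_one hK0 (hWU0.1 r s h).2
  have hinv := liftClock_invariant hK hexec hmod hadj
  have hinit : ∀ r, liftClock sched (e 0 p₀) δ0 r 0 ≤ k := fun r => by
    obtain ⟨w, hw⟩ := hconn.exists_walk_length_eq_dist p₀ r
    have hlen := walkDelay_le_length hK0 hWU0.1 w
    rw [hδ0, hw] at hlen
    have : Nonempty V := ⟨p₀⟩
    have hdiam : G.dist p₀ r ≤ G.diam := dist_le_diam (connected_iff_ediam_ne_top.1 hconn)
    rw [liftClock_zero]
    omega
  have hlead : ∀ t p q, p ∈ sched t → G.Adj p q →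
      liftClock sched (e 0 p₀) δ0 p t ≤ liftClock sched (e 0 p₀) δ0 q t := fun t p q hp h =>
    ((hexec t).2.1 p hp).le_lift hK (hinv t).1 h ((hinv t).2 p q h)
  obtain ⟨w, hw⟩ := hconn.exists_walk_length_eq_dist p q
  obtain ⟨t', ht', hk', hcausal⟩ :=
    exists_causalLe_of_walk hlead hinit w hev (by rw [hw]; exact hq)
  refine ⟨t', ?_, ht', hcausal⟩
  by_contra! hlt
  have hle := liftClock_mono sched (e 0 p₀) δ0 q hlt.le
  have := htqk.2 t' (by rw [htqk.1] at hle; omega)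
  omega
end

section
/- Closure for the layered clock: for any choice of the side condition cond, the predicate WU₁ ∩ WU₂ is closed under steps of the layered-clock algorithm; that is, if the configuration γ = (γ₁, γ₂) satisfies WU₁ and WU₂, and γ ↦ γ' is a step in which a nonempty set of processes each execute an enabled action — where the normal action at p requires NormalStep¹_p and LocallyCorrect²_p, sets r₁(p) := φ₁(r₁(p)), and may additionally set r₂(p) := φ₂(r₂(p)) but only when NormalStep²_p holds — then γ' satisfies WU₁ and WU₂. -/
open SimpleGraph

/-- Guard `NormalStep_p` (for modulus `K`): `γ(p)` is a ring value and every neighbor `q`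
satisfies `γ(q) = γ(p)` or `γ(q) = φ(γ(p))`. -/
def NormalStep {V : Type*} (G : SimpleGraph V) (K : ℤ) (γ : V → ℤ) (p : V) : Prop :=
  (0 ≤ γ p ∧ γ p < K) ∧ ∀ q : V, G.Adj p q → γ q = γ p ∨ γ q = phiInc K (γ p)

/-- Guard `LocallyCorrect_p` (for modulus `K`): `γ(p)` is a ring value and every neighbor
`q` has a ring value with `γ(p) = γ(q)`, `γ(p) = φ(γ(q))` or `φ(γ(p)) = γ(q)`. -/
def LocallyCorrect {V : Type*} (G : SimpleGraph V) (K : ℤ) (γ : V → ℤ) (p : V) : Prop :=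
  (0 ≤ γ p ∧ γ p < K) ∧ ∀ q : V, G.Adj p q → (0 ≤ γ q ∧ γ q < K) ∧
    (γ p = γ q ∨ γ p = phiInc K (γ q) ∨ phiInc K (γ p) = γ q)

/-- A step of the layered-clock algorithm: a nonempty set `S` of processes, each of which
satisfies `NormalStep¹` and `LocallyCorrect²`, executes the normal action: it sets
`r₁(p) := φ₁(r₁(p))`, and may additionally set `r₂(p) := φ₂(r₂(p))`, but only when
`NormalStep²_p` holds; all other processes keep both register values. -/
def LayerStep {V : Type*} (G : SimpleGraph V) (K₁ K₂ : ℤ)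
    (r₁ r₂ r₁' r₂' : V → ℤ) (S : Set V) : Prop :=
  S.Nonempty ∧
  (∀ p ∈ S, NormalStep G K₁ r₁ p ∧ LocallyCorrect G K₂ r₂ p ∧
    r₁' p = phiInc K₁ (r₁ p) ∧
    (r₂' p = r₂ p ∨ (NormalStep G K₂ r₂ p ∧ r₂' p = phiInc K₂ (r₂ p)))) ∧
  (∀ p ∉ S, r₁' p = r₁ p ∧ r₂' p = r₂ p)

theorem phiInc_mem_ring {K x : ℤ} (h0 : 0 ≤ x) (h1 : x < K) :
    0 ≤ phiInc K x ∧ phiInc K x < K := by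
  have hK : 0 < K := h0.trans_lt h1
  rw [phiInc, if_pos h0]
  exact ⟨Int.emod_nonneg _ hK.ne', Int.emod_lt_of_pos _ hK⟩

theorem locComp_self {K : ℤ} (a : ℤ) : LocComp K a a := by
  simp [LocComp]

theorem LocComp.symm {K a b : ℤ} (h : LocComp K a b) : LocComp K b a := by
  unfold LocComp at *
  rwa [min_comm]

theorem locComp_phiInc {K a : ℤ} (hK : 3 ≤ K) (h0 : 0 ≤ a) : LocComp K (phiInc K a) a := by
  unfold LocComp phiInc
  rw [if_pos h0, Int.emod_sub_emod, add_sub_cancel_left,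
    Int.emod_eq_of_lt (by omega) (by omega)]
  exact min_le_left _ _

theorem LocComp.phiInc {K a b : ℤ} (ha : 0 ≤ a) (hb : 0 ≤ b) (h : LocComp K a b) :
    LocComp K (phiInc K a) (phiInc K b) := by
  unfold LocComp _root_.phiInc at *
  rw [if_pos ha, if_pos hb, Int.emod_sub_emod, Int.emod_sub_emod, Int.sub_emod_emod,
    Int.sub_emod_emod, add_sub_add_right_eq_sub, add_sub_add_right_eq_sub]
  exact h

theorem locComp_phiInc_of_normalStep {V : Type*} {G : SimpleGraph V} {K : ℤ} (hK : 3 ≤ K)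
    {r : V → ℤ} {p q : V} (hp : NormalStep G K r p) (hpq : G.Adj p q) :
    LocComp K (phiInc K (r p)) (r q) := by
  rcases hp.2 q hpq with h | h <;> rw [h]
  · exact locComp_phiInc hK hp.1.1
  · exact locComp_self _

/-- `WU` is closed under any (possibly empty) simultaneous execution of normal steps. -/
theorem WU.of_normalStep {V : Type*} {G : SimpleGraph V} {K : ℤ} (hK : 3 ≤ K)
    {r r' : V → ℤ} (hWU : WU G K r)
    (hstep : ∀ p, r' p = r p ∨ (NormalStep G K r p ∧ r' p = phiInc K (r p))) :
    WU G K r' := by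
  intro p q hpq
  obtain ⟨⟨hp0, hp1⟩, hcomp⟩ := hWU p q hpq
  obtain ⟨⟨hq0, -⟩, -⟩ := hWU q p hpq.symm
  rcases hstep p with hp | ⟨hnp, hp⟩ <;> rcases hstep q with hq | ⟨hnq, hq⟩ <;> rw [hp, hq]
  · exact ⟨⟨hp0, hp1⟩, hcomp⟩
  · exact ⟨⟨hp0, hp1⟩, (locComp_phiInc_of_normalStep hK hnq hpq.symm).symm⟩
  · exact ⟨phiInc_mem_ring hp0 hp1, locComp_phiInc_of_normalStep hK hnp hpq⟩
  · exact ⟨phiInc_mem_ring hp0 hp1, hcomp.phiInc hp0 hq0⟩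

/-- Closure for the layered clock: for any choice of the side condition `cond` (the step
relation allows a process either to increment its slave register or not, and hence covers
every choice of `cond`), the predicate `WU₁ ∩ WU₂` is closed under steps of the
layered-clock algorithm. -/
theorem layered_clock_WU_closed {V : Type*} [Fintype V] (G : SimpleGraph V)
    (hconn : G.Connected) (hn : 2 ≤ Fintype.card V)
    (K₁ K₂ α₁ α₂ : ℤ) (hK₁ : 3 ≤ K₁) (hK₂ : 3 ≤ K₂) (hα₁ : 0 ≤ α₁) (hα₂ : 0 ≤ α₂)
    (r₁ r₂ r₁' r₂' : V → ℤ)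
    (hX₁ : ∀ p : V, -α₁ ≤ r₁ p ∧ r₁ p < K₁) (hX₂ : ∀ p : V, -α₂ ≤ r₂ p ∧ r₂ p < K₂)
    (S : Set V)
    (hWU₁ : WU G K₁ r₁) (hWU₂ : WU G K₂ r₂)
    (hstep : LayerStep G K₁ K₂ r₁ r₂ r₁' r₂' S) :
    WU G K₁ r₁' ∧ WU G K₂ r₂' := by
  obtain ⟨-, hS, hnS⟩ := hstep
  refine ⟨hWU₁.of_normalStep hK₁ fun p => ?_, hWU₂.of_normalStep hK₂ fun p => ?_⟩
  · by_cases hp : p ∈ S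
    · exact Or.inr ⟨(hS p hp).1, (hS p hp).2.2.1⟩
    · exact Or.inl (hnS p hp).1
  · by_cases hp : p ∈ S
    · exact (hS p hp).2.2.2
    · exact Or.inl (hnS p hp).2
end
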